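/- arXiv:math/0403076 — 4 statements merged into one kernel-verified Lean document; each statement's English description precedes it below -/
import Mathlib

section
/- Let x, y ∈ X_h. If x ⪰ 0 and x − y = xy, then x ⪰ y and y ⪰ 0 (indeed y ⪰ y² ⪰ 0). -/
noncomputable section

open scoped ComplexOrder

variable {X : Type*} [Ring X] [Algebra ℂ X] [StarRing X]

/-- The hermitian "real part" `Re x = (x + x*)/2`. -/
def reP (x : X) : X := ((2 : ℂ)⁻¹) • (x + star x)

/-- The hermitian "imaginary part" `Im x = (i/2)(x* − x)`. -/
def imP (x : X) : X := (Complex.I * (2 : ℂ)⁻¹) • (star x - x)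

/-- `C` is an m-admissible wedge in the hermitian part of `X`. -/
def IsMAdmissibleWedge (C : Set X) : Prop :=
  (∀ x ∈ C, star x = x) ∧ (1 : X) ∈ C ∧
  (∀ x ∈ C, ∀ y ∈ C, x + y ∈ C) ∧
  (∀ x ∈ C, ∀ r : ℝ, 0 ≤ r → (r : ℂ) • x ∈ C) ∧
  (∀ x ∈ C, ∀ z : X, star z * x * z ∈ C)

/-- The algebraically bounded part `X_b(C)`: those `x` with
`λ·1 ⪰ Re x ⪰ −λ·1` and `λ·1 ⪰ Im x ⪰ −λ·1` for some `λ > 0`,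
where `u ⪰ v` means `u − v ∈ C`. -/
def boundedPart (C : Set X) : Set X :=
  {x | ∃ r : ℝ, 0 < r ∧
    (r : ℂ) • (1 : X) - reP x ∈ C ∧ (r : ℂ) • (1 : X) + reP x ∈ C ∧
    (r : ℂ) • (1 : X) - imP x ∈ C ∧ (r : ℂ) • (1 : X) + imP x ∈ C}

/-- Lemma 2.1(iii): if `x ⪰ 0` and `x − y = xy` for hermitian `x, y`, then
`x ⪰ y` and `y ⪰ y² ⪰ 0`; in particular `y ⪰ 0`. -/
theorem stmt5 {X : Type*} [Ring X] [Algebra ℂ X] [StarRing X]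
    (C : Set X) (hC : IsMAdmissibleWedge C)
    (x y : X) (hx : star x = x) (hy : star y = y)
    (hx0 : x ∈ C) (hxy : x - y = x * y) :
    x - y ∈ C ∧ y - y ^ 2 ∈ C ∧ y ^ 2 ∈ C ∧ y ∈ C := by
  obtain ⟨-, h1, hadd, -, hconj⟩ := hC
  have hyx : x - y = y * x := by
    simpa [hx, hy] using congrArg star hxy
  have hsq : y ^ 2 ∈ C := by
    simpa [hy, sq] using hconj 1 h1 y
  have hsub : y - y ^ 2 ∈ C := by
    have h := hconj x hx0 (1 - y)
    have hy' : (1 - y) * x = y := by rw [sub_mul, one_mul, ← hyx, sub_sub_cancel]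
    rwa [star_sub, star_one, hy, hy', mul_sub, mul_one, ← sq] at h
  refine ⟨?_, hsub, hsq, ?_⟩
  · have h := hadd _ hsq _ (hconj x hx0 y)
    rwa [hy, ← hyx, sub_mul, ← sq, add_sub_cancel, ← hxy] at h
  · simpa using hadd _ hsub _ hsq
end
end

section
/- Let z ∈ X_b(C) with z* = z, and suppose z is not an internal point of C_b in the real vector space X_b(C)_h. Then there exists a ℂ-linear functional F on X_b(C) such that F(1) = 1, F(x*) = conj(F(x)) for all x ∈ X_b(C), F(x) ≥ 0 for all x ∈ C_b, and F(z) is a real number ≤ 0. -/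
noncomputable section

open scoped ComplexOrder

variable {X : Type*} [Ring X] [Algebra ℂ X] [StarRing X]

/-- `u` is an internal point of `M ⊆ X_b(C)_h` within the real vector space
`X_b(C)_h` of hermitian elements of `X_b(C)`. -/
def IsInternalPoint (C : Set X) (M : Set X) (u : X) : Prop :=
  ∀ y : X, y ∈ boundedPart C → star y = y →
    ∃ ε : ℝ, 0 < ε ∧ ∀ δ : ℝ, |δ| < ε → u + (δ : ℂ) • y ∈ M

namespace IsMAdmissibleWedge

variable {C : Set X}

lemma real_smul_mem (hC : IsMAdmissibleWedge C) {x : X} (hx : x ∈ C) {r : ℝ} (hr : 0 ≤ r) :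
    r • x ∈ C := by
  simpa using hC.2.2.2.1 x hx r hr

lemma add_mem (hC : IsMAdmissibleWedge C) {x y : X} (hx : x ∈ C) (hy : y ∈ C) : x + y ∈ C :=
  hC.2.2.1 x hx y hy

lemma conj_mem (hC : IsMAdmissibleWedge C) {x : X} (hx : x ∈ C) (z : X) : star z * x * z ∈ C :=
  hC.2.2.2.2 x hx z

/-- The involution is real-linear as soon as an m-admissible wedge exists. -/
lemma star_real_smul (hC : IsMAdmissibleWedge C) (r : ℝ) (x : X) :
    star (r • x) = r • star x := by
  have nonneg (t : ℝ) (ht : 0 ≤ t) (y : X) : star (t • y) = t • star y := by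
    have h := hC.1 _ (hC.real_smul_mem hC.2.1 ht)
    calc star (t • y) = star ((t • (1 : X)) * y) := by rw [smul_mul_assoc, one_mul]
      _ = t • star y := by rw [star_mul, h, mul_smul_comm, mul_one]
  rcases le_total 0 r with hr | hr
  · exact nonneg r hr x
  · have h := nonneg (-r) (neg_nonneg.2 hr) x
    rw [neg_smul, neg_smul, star_neg] at h
    exact neg_injective h

/-- The real vector space of hermitian elements of `X_b(C)`. -/
def hermitianBounded (hC : IsMAdmissibleWedge C) : Submodule ℝ X where
  carrier := {x | star x = x ∧ ∃ r : ℝ, 0 < r ∧ r • (1 : X) - x ∈ C ∧ r • (1 : X) + x ∈ C}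
  zero_mem' := ⟨star_zero X, 1, one_pos, by simpa using hC.2.1, by simpa using hC.2.1⟩
  add_mem' := by
    rintro x y ⟨hx, r, hr, hx₁, hx₂⟩ ⟨hy, s, hs, hy₁, hy₂⟩
    refine ⟨by rw [star_add, hx, hy], r + s, add_pos hr hs, ?_, ?_⟩
    · convert! hC.add_mem hx₁ hy₁ using 1
      module
    · convert! hC.add_mem hx₂ hy₂ using 1
      module
  smul_mem' := by
    rintro t x ⟨hx, r, hr, hx₁, hx₂⟩
    have h₁ := hC.real_smul_mem hx₁ (abs_nonneg t)
    have h₂ := hC.real_smul_mem hx₂ (abs_nonneg t)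
    have h := hC.2.1
    refine ⟨by rw [hC.star_real_smul, hx], |t| * r + 1, by positivity, ?_, ?_⟩
    · rcases abs_choice t with ht | ht <;> rw [ht] at h₁ h₂ ⊢
      · convert! hC.add_mem h₁ h using 1
        module
      · convert! hC.add_mem h₂ h using 1
        module
    · rcases abs_choice t with ht | ht <;> rw [ht] at h₁ h₂ ⊢
      · convert! hC.add_mem h₂ h using 1
        module
      · convert! hC.add_mem h₁ h using 1
        module

lemma mem_hermitianBounded_iff (hC : IsMAdmissibleWedge C) {x : X} :
    x ∈ hC.hermitianBounded ↔
      star x = x ∧ ∃ r : ℝ, 0 < r ∧ r • (1 : X) - x ∈ C ∧ r • (1 : X) + x ∈ C :=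
  Iff.rfl

lemma reP_of_star_eq {x : X} (hx : star x = x) : reP x = x := by
  rw [reP, hx, ← two_smul ℂ x, smul_smul]
  norm_num

lemma imP_of_star_eq {x : X} (hx : star x = x) : imP x = 0 := by
  rw [imP, hx, sub_self, smul_zero]

lemma mem_boundedPart_iff (hC : IsMAdmissibleWedge C) {x : X} (hx : star x = x) :
    x ∈ boundedPart C ↔ x ∈ hC.hermitianBounded := by
  simp only [boundedPart, Set.mem_ofPred_eq, reP_of_star_eq hx, imP_of_star_eq hx,
    hC.mem_hermitianBounded_iff, Complex.coe_smul, sub_zero, add_zero, hx, true_and]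
  refine exists_congr fun r ↦ and_congr_right fun hr ↦ ⟨fun h ↦ ⟨h.1, h.2.1⟩, fun h ↦ ?_⟩
  have := hC.real_smul_mem hC.2.1 hr.le
  exact ⟨h.1, h.2, this, this⟩

lemma one_mem_hermitianBounded (hC : IsMAdmissibleWedge C) : (1 : X) ∈ hC.hermitianBounded := by
  refine ⟨star_one X, 1, one_pos, ?_, ?_⟩
  · simpa using hC.real_smul_mem hC.2.1 le_rfl
  · simpa using hC.add_mem hC.2.1 hC.2.1

/-- An element dominating a positive multiple of `1` is an internal point of `C_b`. -/
lemma isInternalPoint_of_sub_mem (hC : IsMAdmissibleWedge C) {z : X}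
    (hz : z ∈ hC.hermitianBounded) {ε : ℝ} (hε : 0 < ε) (h : z - ε • (1 : X) ∈ C) :
    IsInternalPoint C (C ∩ boundedPart C) z := by
  intro y hy hyh
  rw [hC.mem_boundedPart_iff hyh] at hy
  obtain ⟨-, r, hr, hy₁, hy₂⟩ := hy
  refine ⟨ε / r, div_pos hε hr, fun δ hδ ↦ ?_⟩
  have hy : y ∈ hC.hermitianBounded := ⟨hyh, r, hr, hy₁, hy₂⟩
  have hmem := hC.hermitianBounded.add_mem hz (hC.hermitianBounded.smul_mem δ hy)
  rw [Complex.coe_smul]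
  refine ⟨?_, (hC.mem_boundedPart_iff hmem.1).2 hmem⟩
  have hle : 0 ≤ ε - |δ| * r := by
    rw [lt_div_iff₀ hr] at hδ
    linarith
  have h' := hC.add_mem h (hC.real_smul_mem hC.2.1 hle)
  rcases abs_choice δ with hδ' | hδ'
  · convert! hC.add_mem h' (hC.real_smul_mem hy₂ (abs_nonneg δ)) using 1
    rw [hδ']
    module
  · convert! hC.add_mem h' (hC.real_smul_mem hy₁ (abs_nonneg δ)) using 1
    rw [hδ']
    module

/-- A real state on the hermitian bounded elements that is nonpositive at a given non-internal
point, extended arbitrarily to the whole algebra. -/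
lemma exists_real_state (hC : IsMAdmissibleWedge C) {z : X} (hz : z ∈ hC.hermitianBounded)
    (hzi : ∀ ε : ℝ, 0 < ε → z - ε • (1 : X) ∉ C) :
    ∃ f : X →ₗ[ℝ] ℝ, f 1 = 1 ∧ (∀ x ∈ C, x ∈ hC.hermitianBounded → 0 ≤ f x) ∧ f z ≤ 0 := by
  have hneg (t : ℝ) (ht : t < 0) : t • (1 : X) ∉ C := by
    intro h
    obtain ⟨-, r, hr, -, hz₂⟩ := hz
    refine hzi 1 one_pos ?_
    have hpos : 0 ≤ (r + 1) / -t := div_nonneg (by linarith) (by linarith)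
    convert! hC.add_mem hz₂ (hC.real_smul_mem h hpos) using 1
    rw [smul_smul, show (r + 1) / -t * t = -(r + 1) by field_simp [ht.ne]]
    module
  let V := hC.hermitianBounded
  let u : V := ⟨1, hC.one_mem_hermitianBounded⟩
  have hu : u ≠ 0 := by
    intro h
    have h1 : (1 : X) = 0 := congrArg Subtype.val h
    refine hneg (-1) (by norm_num) ?_
    have := hC.2.1
    rw [h1] at this ⊢
    rwa [smul_zero]
  let s : PointedCone ℝ V :=
    { carrier := {x | ∃ a : ℝ, 0 ≤ a ∧ (x : X) + a • z ∈ C}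
      zero_mem' := ⟨0, le_rfl, by simpa using hC.real_smul_mem hC.2.1 le_rfl⟩
      add_mem' := by
        rintro x y ⟨a, ha, hx⟩ ⟨b, hb, hy⟩
        refine ⟨a + b, add_nonneg ha hb, ?_⟩
        convert! hC.add_mem hx hy using 1
        rw [Submodule.coe_add]
        module
      smul_mem' := by
        rintro ⟨c, hc⟩ x ⟨a, ha, hx⟩
        refine ⟨c * a, mul_nonneg hc ha, ?_⟩
        convert! hC.real_smul_mem hx hc using 1
        change c • (x : X) + _ = _
        module }
  have hs (x : V) : x ∈ s ↔ ∃ a : ℝ, 0 ≤ a ∧ (x : X) + a • z ∈ C := Iff.rfl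
  obtain ⟨g, hg, hgs⟩ := riesz_extension s (LinearPMap.mkSpanSingleton (K := ℝ) u (1 : ℝ) hu)
    (by
      rintro ⟨x, hx⟩ hxs
      obtain ⟨t, rfl⟩ := Submodule.mem_span_singleton.1 hx
      rw [LinearPMap.mkSpanSingleton'_apply, smul_eq_mul, mul_one]
      obtain ⟨a, ha, hxa⟩ := (hs _).1 hxs
      change t • (1 : X) + a • z ∈ C at hxa
      by_contra! ht
      rcases ha.eq_or_lt with rfl | ha
      · exact hneg t ht (by simpa using hxa)
      · refine hzi (-t / a) (div_pos (neg_pos.2 ht) ha) ?_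
        convert! hC.real_smul_mem hxa (inv_nonneg.2 ha.le) using 1
        rw [smul_add, smul_smul, smul_smul, inv_mul_cancel₀ ha.ne', div_eq_inv_mul]
        module)
    (by
      rintro ⟨y, hyh, r, hr, hy₁, hy₂⟩
      refine ⟨⟨r • u, Submodule.mem_span_singleton.2 ⟨r, rfl⟩⟩, (hs _).2 ⟨0, le_rfl, ?_⟩⟩
      rw [zero_smul, add_zero]
      exact hy₂)
  obtain ⟨f, hf⟩ := g.exists_extend
  have hfg (x : V) : f x = g x := by rw [← hf]; rfl
  refine ⟨f, ?_, fun x hx hxV ↦ ?_, ?_⟩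
  · have h := hg ⟨u, Submodule.mem_span_singleton_self u⟩
    rw [LinearPMap.mkSpanSingleton_apply] at h
    exact (hfg u).trans h
  · exact (hfg ⟨x, hxV⟩).symm ▸ hgs ⟨x, hxV⟩ ⟨0, le_rfl, by simpa using hx⟩
  · have h := hgs (-⟨z, hz⟩) ⟨1, zero_le_one, by
      simpa using hC.real_smul_mem hC.2.1 le_rfl⟩
    rw [map_neg] at h
    rw [hfg ⟨z, hz⟩]
    linarith

/-- A central projection `e` splitting off the part of the algebra on which the involution is
conjugate-linear; the wedge contains both `1 - e` and its negative. -/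
lemma exists_central_projection (hC : IsMAdmissibleWedge C) :
    ∃ e : X, (∀ x, e * x = x * e) ∧ star e = e ∧ e * e = e ∧ e - 1 ∈ C ∧
      ∀ (c : ℂ) (x : X), star (c • (e * x)) = (starRingEnd ℂ) c • star (e * x) := by
  set J : X := star (Complex.I • (1 : X)) with hJ
  have star_I (x : X) : star (Complex.I • x) = star x * J := by
    rw [hJ, ← star_mul, smul_mul_assoc, one_mul]
  have hJc (x : X) : J * x = x * J := by
    calc J * x = star (star x * (Complex.I • (1 : X))) := by rw [star_mul, star_star]
      _ = x * J := by rw [mul_smul_comm, mul_one, star_I, star_star]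
  have hJJ : J * J = -1 := by
    rw [← star_I, smul_smul, Complex.I_mul_I, neg_smul, one_smul, star_neg, star_one]
  set p : X := Complex.I • J with hp
  have hpc (x : X) : p * x = x * p := by rw [hp, smul_mul_assoc, hJc, mul_smul_comm]
  have hpp : p * p = 1 := by
    rw [hp, smul_mul_smul_comm, Complex.I_mul_I, hJJ, neg_smul, one_smul, neg_neg]
  have hps : star p = p := by
    rw [hp, star_I, hJ, star_star, ← hJ, smul_mul_assoc, one_mul]
  have hpC : p ∈ C := by
    have h := hC.conj_mem hC.2.1 (Complex.I • (1 : X))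
    rwa [mul_one, ← hJ, mul_smul_comm, mul_one] at h
  set e : X := (2⁻¹ : ℝ) • (1 + p) with he
  have hec (x : X) : e * x = x * e := by
    rw [he, smul_mul_assoc, mul_smul_comm, add_mul, mul_add, hpc, one_mul, mul_one]
  have hes : star e = e := by rw [he, hC.star_real_smul, star_add, star_one, hps]
  have hee : e * e = e := by
    rw [he, smul_mul_smul_comm, add_mul, mul_add, mul_add, hpp, one_mul, one_mul, mul_one]
    module
  have hpe : p * e = e := by
    rw [he, mul_smul_comm, mul_add, hpp, mul_one, add_comm]
  have hJe : e * J = -(Complex.I • e) := by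
    have h : Complex.I • (p * e) = Complex.I • e := by rw [hpe]
    rw [hp, smul_mul_assoc, smul_smul, Complex.I_mul_I, neg_smul, one_smul, hJc] at h
    rw [← h, neg_neg]
  refine ⟨e, hec, hes, hee, ?_, fun c x ↦ ?_⟩
  · have h := hC.conj_mem hpC (1 - e)
    have h1 : (1 - e) * p * (1 - e) = e - 1 := by
      have h2 : (1 - e) * p = p - e := by rw [sub_mul, one_mul, ← hpc, hpe]
      rw [h2, mul_sub, mul_one, sub_mul, hpe, hee, sub_self, sub_zero, he]
      module
    rwa [star_sub, star_one, hes, h1] at h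
  · have hIx : star (Complex.I • (e * x)) = -(Complex.I • star (e * x)) := by
      rw [star_I, star_mul, hes, mul_assoc, hJe, mul_neg, mul_smul_comm]
    have hc (y : X) (d : ℂ) : d • y = d.re • y + d.im • (Complex.I • y) := by
      rw [← Complex.coe_smul, ← Complex.coe_smul, smul_smul, ← add_smul, Complex.re_add_im]
    rw [hc _ c, star_add, hC.star_real_smul, hC.star_real_smul, hIx, hc _ (starRingEnd ℂ c),
      Complex.conj_re, Complex.conj_im, smul_neg, neg_smul]

/-- A functional that is nonnegative on `C_b` vanishes on the complement of a hermitian central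
idempotent `e` with `e - 1 ∈ C`. -/
lemma map_mul_eq (hC : IsMAdmissibleWedge C) {f : X →ₗ[ℝ] ℝ}
    (hf : ∀ x ∈ C, x ∈ hC.hermitianBounded → 0 ≤ f x) {e : X} (hec : ∀ x, e * x = x * e)
    (hes : star e = e) (hee : e * e = e) (heC : e - 1 ∈ C) {x : X}
    (hx : x ∈ hC.hermitianBounded) : f (e * x) = f x := by
  have mem (y : X) (hy : y ∈ hC.hermitianBounded) : y - e * y ∈ C := by
    obtain ⟨-, r, hr, -, hy₂⟩ := hy
    convert! hC.add_mem (hC.real_smul_mem heC hr.le) (hC.conj_mem hy₂ (1 - e)) using 1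
    rw [star_sub, star_one, hes]
    have h : (1 - e) * (r • (1 : X) + y) * (1 - e) = (1 - e) * (1 - e) * (r • (1 : X) + y) := by
      have hcomm : (1 - e) * (r • (1 : X) + y) = (r • (1 : X) + y) * (1 - e) := by
        rw [sub_mul, mul_sub, one_mul, mul_one, hec]
      rw [mul_assoc, ← hcomm, mul_assoc]
    have hidem : (1 - e) * (1 - e) = 1 - e := by
      rw [mul_sub, mul_one, sub_mul, one_mul, hee, sub_self, sub_zero]
    rw [h, hidem, mul_add, mul_smul_comm, mul_one, sub_mul, one_mul]
    module
  have h₁ := mem x hx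
  have h₂ := mem (-x) (hC.hermitianBounded.neg_mem hx)
  have hneg : -x - e * -x = -(x - e * x) := by rw [mul_neg]; abel
  rw [hneg] at h₂
  have hV : x - e * x ∈ hC.hermitianBounded := by
    refine ⟨hC.1 _ h₁, 1, one_pos, ?_, ?_⟩ <;> rw [one_smul]
    · rw [sub_eq_add_neg]
      exact hC.add_mem hC.2.1 h₂
    · exact hC.add_mem hC.2.1 h₁
  have p₁ := hf _ h₁ hV
  have p₂ := hf _ h₂ (hC.hermitianBounded.neg_mem hV)
  rw [map_neg] at p₂
  rw [map_sub] at p₁ p₂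
  linarith

end IsMAdmissibleWedge

/-- Lemma 2.3: if a hermitian `z ∈ X_b(C)` is not an internal point of
`C_b = C ∩ X_b(C)` in `X_b(C)_h`, then there is a `C_b`-positive state `F` on
`X_b(C)` with `F(z) ≤ 0`. -/
theorem stmt7 {X : Type*} [Ring X] [Algebra ℂ X] [StarRing X]
    (C : Set X) (hC : IsMAdmissibleWedge C)
    (z : X) (hz : z ∈ boundedPart C) (hzh : star z = z)
    (hnotint : ¬ IsInternalPoint C (C ∩ boundedPart C) z) :
    ∃ F : X → ℂ,
      (∀ x ∈ boundedPart C, ∀ y ∈ boundedPart C, F (x + y) = F x + F y) ∧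
      (∀ c : ℂ, ∀ x ∈ boundedPart C, F (c • x) = c * F x) ∧
      F 1 = 1 ∧
      (∀ x ∈ boundedPart C, F (star x) = (starRingEnd ℂ) (F x)) ∧
      (∀ x ∈ C ∩ boundedPart C, 0 ≤ F x) ∧
      F z ≤ 0 := by
  have hzV := (hC.mem_boundedPart_iff hzh).1 hz
  obtain ⟨f, hf1, hfC, hfz⟩ := hC.exists_real_state hzV fun ε hε h ↦
    hnotint (hC.isInternalPoint_of_sub_mem hzV hε h)
  obtain ⟨e, hec, hes, hee, heC, hstar⟩ := hC.exists_central_projection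
  have hfe {x : X} (hx : x ∈ hC.hermitianBounded) : f (e * x) = f x :=
    hC.map_mul_eq hfC hec hes hee heC hx
  let F : X → ℂ := fun x ↦ f (reP (e * x)) + f (imP (e * x)) * Complex.I
  have F_herm {x : X} (hx : x ∈ hC.hermitianBounded) : F x = f x := by
    have h : star (e * x) = e * x := by rw [star_mul, hes, hx.1, hec]
    simp only [F]
    rw [IsMAdmissibleWedge.reP_of_star_eq h, IsMAdmissibleWedge.imP_of_star_eq h, hfe hx,
      map_zero, Complex.ofReal_zero, zero_mul, add_zero]
  refine ⟨F, fun x _ y _ ↦ ?_, fun c x _ ↦ ?_, ?_, fun x _ ↦ ?_, fun x hx ↦ ?_, ?_⟩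
  · have hre : reP (e * (x + y)) = reP (e * x) + reP (e * y) := by
      simp only [reP, mul_add, star_add]
      module
    have him : imP (e * (x + y)) = imP (e * x) + imP (e * y) := by
      simp only [imP, mul_add, star_add]
      module
    simp only [F, hre, him, map_add, Complex.ofReal_add]
    ring
  · have hre : reP (e * (c • x)) = c.re • reP (e * x) - c.im • imP (e * x) := by
      simp only [reP, imP, mul_smul_comm, hstar, ← Complex.coe_smul]
      match_scalars <;> apply Complex.ext <;> simp <;> ring
    have him : imP (e * (c • x)) = c.re • imP (e * x) + c.im • reP (e * x) := by
      simp only [reP, imP, mul_smul_comm, hstar, ← Complex.coe_smul]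
      match_scalars <;> apply Complex.ext <;> simp <;> ring
    simp only [F, hre, him, map_add, map_sub, map_smul, smul_eq_mul]
    apply Complex.ext <;> simp
  · rw [F_herm hC.one_mem_hermitianBounded, hf1, Complex.ofReal_one]
  · have hs : e * star x = star (e * x) := by rw [star_mul, hes, hec]
    have hre : reP (e * star x) = reP (e * x) := by
      rw [hs, reP, reP, star_star, add_comm]
    have him : imP (e * star x) = -imP (e * x) := by
      rw [hs, imP, imP, star_star, ← smul_neg, neg_sub]
    simp only [F, hre, him, map_neg]
    apply Complex.ext <;> simp
  · have hxV := (hC.mem_boundedPart_iff (hC.1 x hx.1)).1 hx.2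
    rw [F_herm hxV]
    exact_mod_cast hfC x hx.1 hxV
  · rw [F_herm hzV]
    exact_mod_cast hfz
end
end

section
/- The ∗-algebra X of rational functions generated by the x_{kl} is algebraically bounded: for every f ∈ X there exists λ > 0 such that each of the four functions λ·1 + Re f, λ·1 − Re f, λ·1 + Im f, λ·1 − Im f is a finite sum of functions of the form conj(g)·g with g ∈ X. -/
noncomputable section

variable (d : ℕ)

/-- The coordinate functions `t ↦ t_k` on `ℝ^d`, with `t₀ := 1`. -/
def coordFn (d : ℕ) (k : Fin (d + 1)) : (Fin d → ℝ) → ℝ :=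
  Fin.cases (fun _ => (1 : ℝ)) (fun j t => t j) k

/-- The generators `x_{kl}(t) = t_k t_l (1 + t₁² + ⋯ + t_d²)⁻¹`. -/
def ratGen (d : ℕ) (k l : Fin (d + 1)) : (Fin d → ℝ) → ℂ :=
  fun t => ((coordFn d k t * coordFn d l t) / (1 + ∑ j, t j ^ 2) : ℝ)

/-- The unital ∗-algebra of rational functions generated by the `x_{kl}`. -/
def ratAlg (d : ℕ) : Subalgebra ℂ ((Fin d → ℝ) → ℂ) :=
  Algebra.adjoin ℂ {f | ∃ k l : Fin (d + 1), f = ratGen d k l}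

/-- Finite sums of functions `conj(g)·g` with `g` in the algebra. -/
def ratSumSq (d : ℕ) : Set ((Fin d → ℝ) → ℂ) :=
  {h | ∃ (m : ℕ) (g : Fin m → ((Fin d → ℝ) → ℂ)),
    (∀ i, g i ∈ ratAlg d) ∧ h = ∑ i, star (g i) * g i}

section SumsOfSquares

variable {d : ℕ}

theorem star_mul_self_mem_ratSumSq {g : (Fin d → ℝ) → ℂ} (hg : g ∈ ratAlg d) :
    star g * g ∈ ratSumSq d :=
  ⟨1, fun _ => g, fun _ => hg, by simp⟩

theorem zero_mem_ratSumSq : (0 : (Fin d → ℝ) → ℂ) ∈ ratSumSq d :=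
  ⟨0, Fin.elim0, fun i => i.elim0, by simp⟩

theorem add_mem_ratSumSq {p q : (Fin d → ℝ) → ℂ} (hp : p ∈ ratSumSq d) (hq : q ∈ ratSumSq d) :
    p + q ∈ ratSumSq d := by
  obtain ⟨m, g, hg, rfl⟩ := hp
  obtain ⟨n, h, hh, rfl⟩ := hq
  refine ⟨m + n, Fin.append g h, fun i => ?_, ?_⟩
  · refine Fin.addCases (fun i => ?_) (fun i => ?_) i
    · simpa using hg i
    · simpa using hh i
  · simp [Fin.sum_univ_add]

theorem sum_mem_ratSumSq {ι : Type*} (s : Finset ι) {p : ι → (Fin d → ℝ) → ℂ}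
    (hp : ∀ i ∈ s, p i ∈ ratSumSq d) : ∑ i ∈ s, p i ∈ ratSumSq d :=
  Finset.sum_induction p (· ∈ ratSumSq d) (fun _ _ => add_mem_ratSumSq) zero_mem_ratSumSq hp

theorem mul_mem_ratSumSq {g p : (Fin d → ℝ) → ℂ} (hg : g ∈ ratAlg d) (hp : p ∈ ratSumSq d) :
    star g * g * p ∈ ratSumSq d := by
  obtain ⟨m, h, hh, rfl⟩ := hp
  refine ⟨m, fun i => g * h i, fun i => mul_mem hg (hh i), ?_⟩
  rw [Finset.mul_sum]
  refine Finset.sum_congr rfl fun i _ => ?_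
  rw [star_mul']
  ring

theorem smul_mem_ratSumSq {c : ℝ} (hc : 0 ≤ c) {p : (Fin d → ℝ) → ℂ} (hp : p ∈ ratSumSq d) :
    (c : ℂ) • p ∈ ratSumSq d := by
  have h := mul_mem_ratSumSq (algebraMap_mem (ratAlg d) ((Real.sqrt c : ℝ) : ℂ)) hp
  convert h using 1
  ext t
  have : ((Real.sqrt c : ℝ) : ℂ) * ((Real.sqrt c : ℝ) : ℂ) = c := by
    rw [← Complex.ofReal_mul, Real.mul_self_sqrt hc]
  simp [this]

theorem const_mem_ratSumSq {c : ℝ} (hc : 0 ≤ c) :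
    (c : ℂ) • (1 : (Fin d → ℝ) → ℂ) ∈ ratSumSq d :=
  smul_mem_ratSumSq hc (by simpa using star_mul_self_mem_ratSumSq (one_mem (ratAlg d)))

end SumsOfSquares

section BoundedElements

variable {d : ℕ}

/-- An element `f` of the ∗-algebra is bounded if `f` and `star f` lie in the algebra and
`c - star f * f` is a sum of squares for some constant `c ≥ 0`. -/
def IsSqBounded (d : ℕ) (f : (Fin d → ℝ) → ℂ) : Prop :=
  f ∈ ratAlg d ∧ star f ∈ ratAlg d ∧
    ∃ c : ℝ, 0 ≤ c ∧ (c : ℂ) • (1 : (Fin d → ℝ) → ℂ) - star f * f ∈ ratSumSq d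

theorem IsSqBounded.star {f : (Fin d → ℝ) → ℂ} (hf : IsSqBounded d f) :
    IsSqBounded d (star f) := by
  obtain ⟨h₁, h₂, c, hc, h⟩ := hf
  exact ⟨h₂, by rwa [star_star], c, hc, by rwa [star_star, mul_comm f]⟩

theorem IsSqBounded.add {f g : (Fin d → ℝ) → ℂ} (hf : IsSqBounded d f) (hg : IsSqBounded d g) :
    IsSqBounded d (f + g) := by
  obtain ⟨f₁, f₂, a, ha, hfa⟩ := hf
  obtain ⟨g₁, g₂, b, hb, hgb⟩ := hg
  refine ⟨add_mem f₁ g₁, by rw [star_add]; exact add_mem f₂ g₂, 2 * (a + b), by positivity, ?_⟩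
  convert add_mem_ratSumSq
    (smul_mem_ratSumSq zero_le_two (add_mem_ratSumSq hfa hgb))
    (star_mul_self_mem_ratSumSq (sub_mem f₁ g₁)) using 1
  ext t
  simp
  ring

theorem IsSqBounded.mul {f g : (Fin d → ℝ) → ℂ} (hf : IsSqBounded d f) (hg : IsSqBounded d g) :
    IsSqBounded d (f * g) := by
  obtain ⟨f₁, f₂, a, ha, hfa⟩ := hf
  obtain ⟨g₁, g₂, b, hb, hgb⟩ := hg
  refine ⟨mul_mem f₁ g₁, by rw [star_mul']; exact mul_mem f₂ g₂, a * b, by positivity, ?_⟩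
  convert add_mem_ratSumSq (smul_mem_ratSumSq ha hgb) (mul_mem_ratSumSq g₁ hfa) using 1
  ext t
  simp
  ring

theorem isSqBounded_algebraMap (z : ℂ) :
    IsSqBounded d (algebraMap ℂ ((Fin d → ℝ) → ℂ) z) := by
  refine ⟨algebraMap_mem _ z, algebraMap_mem (ratAlg d) (starRingEnd ℂ z),
    Complex.normSq z, Complex.normSq_nonneg z, ?_⟩
  convert zero_mem_ratSumSq using 1
  ext t
  simp [Complex.normSq_eq_conj_mul_self]

theorem IsSqBounded.smul {f : (Fin d → ℝ) → ℂ} (hf : IsSqBounded d f) (z : ℂ) :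
    IsSqBounded d (z • f) := by
  rw [Algebra.smul_def]
  exact (isSqBounded_algebraMap z).mul hf

theorem star_ratGen (k l : Fin (d + 1)) : star (ratGen d k l) = ratGen d k l := by
  ext t
  exact Complex.conj_ofReal _

theorem sum_sq_coordFn (t : Fin d → ℝ) :
    ∑ k, coordFn d k t ^ 2 = 1 + ∑ j, t j ^ 2 := by
  simp [Fin.sum_univ_succ, coordFn]

theorem sum_star_mul_self_ratGen :
    ∑ p : Fin (d + 1) × Fin (d + 1), star (ratGen d p.1 p.2) * ratGen d p.1 p.2 = 1 := by
  ext t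
  have hpos : 0 < 1 + ∑ j, t j ^ 2 := by positivity
  have key : ∑ p : Fin (d + 1) × Fin (d + 1),
      (coordFn d p.1 t * coordFn d p.2 t / (1 + ∑ j, t j ^ 2)) *
        (coordFn d p.1 t * coordFn d p.2 t / (1 + ∑ j, t j ^ 2)) = 1 := by
    calc _ = ∑ p : Fin (d + 1) × Fin (d + 1),
          coordFn d p.1 t ^ 2 * coordFn d p.2 t ^ 2 / (1 + ∑ j, t j ^ 2) ^ 2 :=
          Finset.sum_congr rfl fun p _ => by
            rw [div_mul_div_comm, ← sq, ← sq, mul_pow]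
      _ = 1 := by
          rw [← Finset.sum_div, Fintype.sum_prod_type]
          simp only [← Finset.sum_mul_sum, sum_sq_coordFn]
          field_simp
  simp only [star_ratGen, Finset.sum_apply, Pi.mul_apply, Pi.one_apply, ratGen]
  exact_mod_cast key

theorem isSqBounded_ratGen (k l : Fin (d + 1)) : IsSqBounded d (ratGen d k l) := by
  have hmem (k l : Fin (d + 1)) : ratGen d k l ∈ ratAlg d :=
    Algebra.subset_adjoin ⟨k, l, rfl⟩
  refine ⟨hmem k l, by rw [star_ratGen]; exact hmem k l, 1, zero_le_one, ?_⟩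
  have h := Finset.add_sum_erase Finset.univ
    (fun p : Fin (d + 1) × Fin (d + 1) => star (ratGen d p.1 p.2) * ratGen d p.1 p.2)
    (Finset.mem_univ (k, l))
  rw [sum_star_mul_self_ratGen] at h
  rw [Complex.ofReal_one, one_smul, ← h, add_sub_cancel_left]
  exact sum_mem_ratSumSq _ fun p _ => star_mul_self_mem_ratSumSq (hmem p.1 p.2)

theorem isSqBounded_of_mem {f : (Fin d → ℝ) → ℂ} (hf : f ∈ ratAlg d) : IsSqBounded d f := by
  induction hf using Algebra.adjoin_induction with
  | mem x hx =>
    obtain ⟨k, l, rfl⟩ := hx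
    exact isSqBounded_ratGen k l
  | algebraMap z => exact isSqBounded_algebraMap z
  | add x y _ _ hx hy => exact hx.add hy
  | mul x y _ _ hx hy => exact hx.mul hy

theorem IsSqBounded.exists_forall_le_add_mem {h : (Fin d → ℝ) → ℂ} (hh : IsSqBounded d h)
    (hsa : Star.star h = h) :
    ∃ c : ℝ, ∀ b : ℝ, c ≤ b → (b : ℂ) • (1 : (Fin d → ℝ) → ℂ) + h ∈ ratSumSq d := by
  obtain ⟨h₁, -, c, -, hc⟩ := hh
  refine ⟨(1 + c) / 2, fun b hb => ?_⟩
  convert add_mem_ratSumSq (const_mem_ratSumSq (sub_nonneg.2 hb))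
    (smul_mem_ratSumSq (by norm_num : (0 : ℝ) ≤ 1 / 2)
      (add_mem_ratSumSq hc (star_mul_self_mem_ratSumSq (add_mem (one_mem _) h₁)))) using 1
  rw [star_add, star_one, hsa]
  ext t
  simp
  ring

end BoundedElements

/-- The example of Section 2: the ∗-algebra generated by the
`x_{kl} = t_k t_l (1 + |t|²)⁻¹` is algebraically bounded. -/
theorem stmt8 (d : ℕ) (hd : 1 ≤ d) (f : (Fin d → ℝ) → ℂ) (hf : f ∈ ratAlg d) :
    ∃ lam : ℝ, 0 < lam ∧
      (lam : ℂ) • (1 : (Fin d → ℝ) → ℂ) + (2 : ℂ)⁻¹ • (f + star f) ∈ ratSumSq d ∧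
      (lam : ℂ) • (1 : (Fin d → ℝ) → ℂ) - (2 : ℂ)⁻¹ • (f + star f) ∈ ratSumSq d ∧
      (lam : ℂ) • (1 : (Fin d → ℝ) → ℂ) + (Complex.I * 2⁻¹) • (star f - f) ∈ ratSumSq d ∧
      (lam : ℂ) • (1 : (Fin d → ℝ) → ℂ) - (Complex.I * 2⁻¹) • (star f - f) ∈ ratSumSq d := by
  have hb := isSqBounded_of_mem hf
  have hre : IsSqBounded d ((2 : ℂ)⁻¹ • (f + star f)) := (hb.add hb.star).smul _
  have him : IsSqBounded d ((Complex.I * 2⁻¹) • (star f - f)) := by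
    rw [sub_eq_add_neg, ← neg_one_smul ℂ f]
    exact (hb.star.add (hb.smul _)).smul _
  have hre_sa : star ((2 : ℂ)⁻¹ • (f + star f)) = (2 : ℂ)⁻¹ • (f + star f) := by
    ext t
    simp
    ring
  have him_sa : star ((Complex.I * 2⁻¹) • (star f - f)) = (Complex.I * 2⁻¹) • (star f - f) := by
    ext t
    simp
    ring
  have hneg {h : (Fin d → ℝ) → ℂ} (hh : IsSqBounded d h) : IsSqBounded d (-h) := by
    rw [← neg_one_smul ℂ h]
    exact hh.smul _
  obtain ⟨c₁, h₁⟩ := hre.exists_forall_le_add_mem hre_sa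
  obtain ⟨c₂, h₂⟩ := (hneg hre).exists_forall_le_add_mem (by rw [star_neg, hre_sa])
  obtain ⟨c₃, h₃⟩ := him.exists_forall_le_add_mem him_sa
  obtain ⟨c₄, h₄⟩ := (hneg him).exists_forall_le_add_mem (by rw [star_neg, him_sa])
  refine ⟨max 1 (max (max c₁ c₂) (max c₃ c₄)), by positivity, h₁ _ (by simp), ?_,
    h₃ _ (by simp), ?_⟩
  · rw [sub_eq_add_neg]
    exact h₂ _ (by simp)
  · rw [sub_eq_add_neg]
    exact h₄ _ (by simp)
end
end

section
/- The ∗-algebra X is algebraically bounded: for every T ∈ X there exists λ > 0 such that each of the four operators λ·I + Re T, λ·I − Re T, λ·I + Im T, λ·I − Im T belongs to Σ²(X), where Re T = (T + T*)/2 and Im T = (i/2)(T* − T). -/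
noncomputable section

/-- The Hilbert space `ℓ²(ℕ^d)`. -/
abbrev L2 (d : ℕ) := lp (fun _ : Fin d → ℕ => ℂ) 2

/-- Bounded operators on `ℓ²(ℕ^d)`. -/
abbrev BdOp (d : ℕ) := L2 d →L[ℂ] L2 d

/-- The standard basis vector `e_𝔫` of `ℓ²(ℕ^d)`. -/
def e2 (d : ℕ) (n : Fin d → ℕ) : L2 d := lp.single 2 n (1 : ℂ)

/-- The total degree `|𝔫| = n₁ + ⋯ + n_d`. -/
def degIdx (d : ℕ) (n : Fin d → ℕ) : ℕ := ∑ k, n k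

/-- The multi-index resulting from applying `a_k` (`k > 0`: annihilation at
slot `k`, `k < 0`: creation at slot `−k`, `k = 0` or `|k| > d`: identity)
to the basis vector `e_𝔫`. -/
def aIdx (d : ℕ) (k : ℤ) (n : Fin d → ℕ) : Fin d → ℕ :=
  if h : 0 < k ∧ k ≤ (d : ℤ) then
    Function.update n ⟨(k - 1).toNat, by omega⟩ (n ⟨(k - 1).toNat, by omega⟩ - 1)
  else if h' : 0 < -k ∧ -k ≤ (d : ℤ) then
    Function.update n ⟨(-k - 1).toNat, by omega⟩ (n ⟨(-k - 1).toNat, by omega⟩ + 1)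
  else n

/-- The coefficient of `a_k e_𝔫`: `√(n_k)` for `k > 0`, `√(n_{−k}+1)` for
`k < 0`, and `1` for `k = 0`, so that `a_k e_𝔫 = (aCoef k 𝔫) • e_{aIdx k 𝔫}`. -/
def aCoef (d : ℕ) (k : ℤ) (n : Fin d → ℕ) : ℝ :=
  if h : 0 < k ∧ k ≤ (d : ℤ) then Real.sqrt (n ⟨(k - 1).toNat, by omega⟩)
  else if h' : 0 < -k ∧ -k ≤ (d : ℤ) then Real.sqrt (n ⟨(-k - 1).toNat, by omega⟩ + 1)
  else 1

/-- The multi-index of `x_{kl} e_𝔫`. -/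
def xIdx (d : ℕ) (k l : ℤ) (n : Fin d → ℕ) : Fin d → ℕ := aIdx d k (aIdx d l n)

/-- The coefficient of `x_{kl} e_𝔫`, where `x_{kl} = a_k a_l (N+α)⁻¹` if
`k ≥ 0` or `l ≥ 0`, and `x_{kl} = (N+α)⁻¹ a_k a_l` if `k < 0` and `l < 0`. -/
def xCoef (d : ℕ) (α : ℝ) (k l : ℤ) (n : Fin d → ℕ) : ℝ :=
  if 0 ≤ k ∨ 0 ≤ l then aCoef d k (aIdx d l n) * aCoef d l n / (degIdx d n + α)
  else aCoef d k (aIdx d l n) * aCoef d l n / (degIdx d (xIdx d k l n) + α)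

/-- The eigenvalue of `y_m = (N + α + m)⁻¹` on `e_𝔫`. -/
def yCoef (d : ℕ) (α : ℝ) (m : ℤ) (n : Fin d → ℕ) : ℝ :=
  ((degIdx d n : ℝ) + α + m)⁻¹

/-- `xop`, `yop` implement the operators `x_{kl}` and `y_n` of Section 3:
each `x_{kl}` (for `|k|, |l| ≤ d`) acts on basis vectors as the continuous
extension of `a_k a_l (N+α)⁻¹` resp. `(N+α)⁻¹ a_k a_l`, and each `y_m` acts
diagonally with eigenvalue `(|𝔫|+α+m)⁻¹`. -/
def IsXYSystem (d : ℕ) (α : ℝ) (xop : ℤ → ℤ → BdOp d) (yop : ℤ → BdOp d) : Prop :=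
  (∀ k l : ℤ, |k| ≤ (d : ℤ) → |l| ≤ (d : ℤ) → ∀ n : Fin d → ℕ,
    xop k l (e2 d n) = (xCoef d α k l n : ℂ) • e2 d (xIdx d k l n)) ∧
  (∀ m : ℤ, ∀ n : Fin d → ℕ, yop m (e2 d n) = (yCoef d α m n : ℂ) • e2 d n)

/-- The auxiliary ∗-algebra `X`: the unital subalgebra of `B(ℓ²(ℕ^d))`
generated by the `x_{kl}` (`k, l = −d, …, d`) and the `y_n` (`n ∈ ℕ₀`). -/
def Xalg (d : ℕ) (xop : ℤ → ℤ → BdOp d) (yop : ℤ → BdOp d) :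
    Subalgebra ℂ (BdOp d) :=
  Algebra.adjoin ℂ
    ({T | ∃ k l : ℤ, |k| ≤ (d : ℤ) ∧ |l| ≤ (d : ℤ) ∧ T = xop k l} ∪
      {T | ∃ m : ℕ, T = yop m})

/-- `Σ²(X)`: finite sums `Σ_i g_i* g_i` with `g_i ∈ X`. -/
def XSumSq (d : ℕ) (X : Subalgebra ℂ (BdOp d)) : Set (BdOp d) :=
  {T | ∃ (m : ℕ) (g : Fin m → BdOp d),
    (∀ i, g i ∈ X) ∧ T = ∑ i, star (g i) * g i}

/-- Continuous linear maps on `ℓ²(ℕ^d)` agreeing on the standard basis are equal. -/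
lemma BdOp.ext_e2 {d : ℕ} {A B : BdOp d} (h : ∀ n, A (e2 d n) = B (e2 d n)) : A = B := by
  refine lp.ext_continuousLinearMap (by norm_num) fun n => ?_
  apply ContinuousLinearMap.ext_ring
  simpa [e2] using h n

lemma inner_e2 (d : ℕ) (m n : Fin d → ℕ) :
    inner ℂ (e2 d m) (e2 d n) = if m = n then (1 : ℂ) else 0 := by
  rw [e2, lp.inner_single_left]
  simp [e2, lp.single_apply, Pi.single_apply]

/-- A weighted shift whose index map is injective on the support of its weights has diagonal
`T* T`, with the squared weights on the diagonal. -/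
lemma star_mul_self_apply_e2 {d : ℕ} {T : BdOp d} {c : (Fin d → ℕ) → ℝ}
    {f : (Fin d → ℕ) → (Fin d → ℕ)} (hT : ∀ n, T (e2 d n) = (c n : ℂ) • e2 d (f n))
    (hf : ∀ m n, c m ≠ 0 → c n ≠ 0 → f m = f n → m = n) (n : Fin d → ℕ) :
    (star T * T) (e2 d n) = ((c n ^ 2 : ℝ) : ℂ) • e2 d n := by
  ext m
  have h : inner ℂ (e2 d m) ((star T * T) (e2 d n)) =
      inner ℂ (e2 d m) (((c n ^ 2 : ℝ) : ℂ) • e2 d n) := by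
    rw [ContinuousLinearMap.star_eq_adjoint, mul_apply_eq_comp,
      ContinuousLinearMap.adjoint_inner_right, hT, hT, inner_smul_left, inner_smul_right,
      inner_smul_right, inner_e2, inner_e2]
    by_cases hmn : m = n
    · subst hmn
      simp [pow_two]
    · by_cases hm : c m = 0
      · simp [hm, hmn]
      by_cases hn : c n = 0
      · simp [hn]
      have : f m ≠ f n := fun h => hmn (hf m n hm hn h)
      simp [hmn, this]
  simpa [e2, lp.inner_single_left] using h

section SumSq

variable {d : ℕ} {X : Subalgebra ℂ (BdOp d)}

lemma XSumSq.star_mul_self {g : BdOp d} (hg : g ∈ X) : star g * g ∈ XSumSq d X :=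
  ⟨1, fun _ => g, fun _ => hg, by simp⟩

lemma XSumSq.zero : (0 : BdOp d) ∈ XSumSq d X :=
  ⟨0, fun _ => 0, fun _ => X.zero_mem, by simp⟩

lemma XSumSq.add {A B : BdOp d} (hA : A ∈ XSumSq d X) (hB : B ∈ XSumSq d X) :
    A + B ∈ XSumSq d X := by
  obtain ⟨m, g, hg, rfl⟩ := hA
  obtain ⟨k, h, hh, rfl⟩ := hB
  refine ⟨m + k, Fin.append g h, fun i => ?_, by simp [Fin.sum_univ_add]⟩
  refine Fin.addCases (fun i => ?_) (fun i => ?_) i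
  · simpa using hg i
  · simpa using hh i

lemma XSumSq.smul {A : BdOp d} (hA : A ∈ XSumSq d X) {r : ℝ} (hr : 0 ≤ r) :
    (r : ℂ) • A ∈ XSumSq d X := by
  obtain ⟨m, g, hg, rfl⟩ := hA
  refine ⟨m, fun i => ((√r : ℝ) : ℂ) • g i, fun i => X.smul_mem (hg i) _, ?_⟩
  rw [Finset.smul_sum]
  refine Finset.sum_congr rfl fun i _ => ?_
  rw [star_smul, smul_mul_smul_comm]
  congr 1
  simp only [Complex.star_def, Complex.conj_ofReal]
  rw [← Complex.ofReal_mul, Real.mul_self_sqrt hr]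

lemma XSumSq.conj {A b : BdOp d} (hA : A ∈ XSumSq d X) (hb : b ∈ X) :
    star b * A * b ∈ XSumSq d X := by
  obtain ⟨m, g, hg, rfl⟩ := hA
  refine ⟨m, fun i => g i * b, fun i => X.mul_mem (hg i) hb, ?_⟩
  simp [Finset.mul_sum, Finset.sum_mul, mul_assoc]

/-- `T` is bounded with respect to `Σ²(X)`: some `λ·1 - T* T` is a sum of squares. -/
def SqBounded (X : Subalgebra ℂ (BdOp d)) (T : BdOp d) : Prop :=
  ∃ lam : ℝ, 0 ≤ lam ∧ (lam : ℂ) • (1 : BdOp d) - star T * T ∈ XSumSq d X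

lemma SqBounded.algebraMap (z : ℂ) : SqBounded X (algebraMap ℂ (BdOp d) z) := by
  refine ⟨‖z‖ ^ 2, by positivity, ?_⟩
  convert XSumSq.zero using 1
  rw [Algebra.algebraMap_eq_smul_one, star_smul, smul_mul_smul_comm, star_one, one_mul,
    ← sub_smul, Complex.star_def, Complex.conj_mul']
  simp

lemma SqBounded.add {a b : BdOp d} (ha : a ∈ X) (hb : b ∈ X) (hA : SqBounded X a)
    (hB : SqBounded X b) : SqBounded X (a + b) := by
  obtain ⟨r, hr, hA⟩ := hA
  obtain ⟨s, hs, hB⟩ := hB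
  refine ⟨2 * r + 2 * s, by positivity, ?_⟩
  have h := XSumSq.add (XSumSq.add (XSumSq.smul hA zero_le_two) (XSumSq.smul hB zero_le_two))
    (XSumSq.star_mul_self (X.sub_mem ha hb))
  convert h using 1
  simp only [star_add, star_sub]
  push_cast
  simp only [smul_sub, add_smul, mul_smul, two_smul]
  noncomm_ring

lemma SqBounded.mul {a b : BdOp d} (hb : b ∈ X) (hA : SqBounded X a) (hB : SqBounded X b) :
    SqBounded X (a * b) := by
  obtain ⟨r, hr, hA⟩ := hA
  obtain ⟨s, hs, hB⟩ := hB
  refine ⟨r * s, by positivity, ?_⟩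
  convert XSumSq.add (XSumSq.conj hA hb) (XSumSq.smul hB hr) using 1
  push_cast
  simp only [star_mul, mul_sub, sub_mul, smul_sub, mul_smul, mul_smul_comm, smul_mul_assoc,
    mul_one, mul_assoc]
  abel

/-- A bounded `T ∈ X` has `λ·1 + (c T + (c T)*)/2` a sum of squares for unimodular `c`. -/
lemma SqBounded.add_re {T : BdOp d} (hT : T ∈ X) {r : ℝ}
    (h : (r : ℂ) • (1 : BdOp d) - star T * T ∈ XSumSq d X) {c : ℂ} (hc : star c * c = 1) :
    (((r + 1) / 2 : ℝ) : ℂ) • (1 : BdOp d) + (2 : ℂ)⁻¹ • (c • T + star c • star T) ∈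
      XSumSq d X := by
  have h1 := XSumSq.add h (XSumSq.star_mul_self (X.add_mem X.one_mem (X.smul_mem hT c)))
  convert XSumSq.smul h1 (r := 2⁻¹) (by norm_num) using 1
  have h2 : (star c • star T) * (c • T) = star T * T := by
    rw [smul_mul_smul_comm, hc, one_smul]
  rw [star_add, star_one, star_smul, add_mul, mul_add, mul_add, h2]
  push_cast
  simp only [one_mul, mul_one, smul_add, smul_sub, smul_smul]
  rw [show ((r : ℂ) + 1) / 2 = 2⁻¹ * r + 2⁻¹ by ring, add_smul]
  abel

/-- The function `p` is the diagonal of a diagonal operator in `Σ²(X)`. -/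
def DiagSumSq (X : Subalgebra ℂ (BdOp d)) (p : (Fin d → ℕ) → ℝ) : Prop :=
  ∃ A ∈ XSumSq d X, ∀ n, A (e2 d n) = (p n : ℂ) • e2 d n

lemma DiagSumSq.add {p q : (Fin d → ℕ) → ℝ} (hp : DiagSumSq X p) (hq : DiagSumSq X q) :
    DiagSumSq X (fun n => p n + q n) := by
  obtain ⟨A, hA, hA'⟩ := hp
  obtain ⟨B, hB, hB'⟩ := hq
  exact ⟨A + B, XSumSq.add hA hB, fun n => by
    rw [add_apply, hA', hB', ← add_smul, Complex.ofReal_add]⟩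

lemma DiagSumSq.smul {p : (Fin d → ℕ) → ℝ} (hp : DiagSumSq X p) {r : ℝ} (hr : 0 ≤ r) :
    DiagSumSq X (fun n => r * p n) := by
  obtain ⟨A, hA, hA'⟩ := hp
  exact ⟨(r : ℂ) • A, XSumSq.smul hA hr, fun n => by
    rw [smul_apply, hA', smul_smul, Complex.ofReal_mul]⟩

lemma DiagSumSq.sum {ι : Type*} (s : Finset ι) {p : ι → (Fin d → ℕ) → ℝ}
    (hp : ∀ i ∈ s, DiagSumSq X (p i)) : DiagSumSq X (fun n => ∑ i ∈ s, p i n) := by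
  classical
  induction s using Finset.induction_on with
  | empty => exact ⟨0, XSumSq.zero, by simp⟩
  | insert i s hi ih =>
    simp only [Finset.sum_insert hi]
    exact (hp i (by simp)).add (ih fun j hj => hp j (by simp [hj]))

/-- A weighted shift is bounded as soon as `λ - c²` is the diagonal of a sum of squares. -/
lemma SqBounded.of_diagSumSq {T : BdOp d} {c : (Fin d → ℕ) → ℝ}
    {f : (Fin d → ℕ) → (Fin d → ℕ)} (hT : ∀ n, T (e2 d n) = (c n : ℂ) • e2 d (f n))
    (hf : ∀ m n, c m ≠ 0 → c n ≠ 0 → f m = f n → m = n)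
    (h : ∃ lam : ℝ, 0 ≤ lam ∧ DiagSumSq X (fun n => lam - c n ^ 2)) : SqBounded X T := by
  obtain ⟨r, hr, A, hA, hA'⟩ := h
  refine ⟨r, hr, ?_⟩
  convert hA using 1
  refine BdOp.ext_e2 fun n => ?_
  rw [hA', sub_apply, star_mul_self_apply_e2 hT hf,
    smul_apply, one_apply_eq_self, ← sub_smul,
    Complex.ofReal_sub]

lemma DiagSumSq.of_shift {T : BdOp d} (hTX : T ∈ X) {c : (Fin d → ℕ) → ℝ}
    {f : (Fin d → ℕ) → (Fin d → ℕ)} (hT : ∀ n, T (e2 d n) = (c n : ℂ) • e2 d (f n))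
    (hf : ∀ m n, c m ≠ 0 → c n ≠ 0 → f m = f n → m = n) :
    DiagSumSq X (fun n => c n ^ 2) :=
  ⟨_, XSumSq.star_mul_self hTX, star_mul_self_apply_e2 hT hf⟩

end SumSq

/-- Affine functions on `ℕ^d` with nonnegative coefficients. -/
def NonnegAffine (d : ℕ) (g : (Fin d → ℕ) → ℝ) : Prop :=
  ∃ (a : ℝ) (b : Fin d → ℝ), 0 ≤ a ∧ (∀ i, 0 ≤ b i) ∧ ∀ n, g n = a + ∑ i, b i * n i

lemma NonnegAffine.const {d : ℕ} {a : ℝ} (ha : 0 ≤ a) : NonnegAffine d (fun _ => a) :=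
  ⟨a, 0, ha, by simp, by simp⟩

lemma NonnegAffine.coord_add {d : ℕ} (i : Fin d) {a : ℝ} (ha : 0 ≤ a) :
    NonnegAffine d (fun n => (n i : ℝ) + a) :=
  ⟨a, Pi.single i 1, ha, fun j => by by_cases h : j = i <;> simp [h],
    fun n => by simp [Pi.single_apply, add_comm]⟩

lemma NonnegAffine.coord {d : ℕ} (i : Fin d) : NonnegAffine d (fun n => (n i : ℝ)) := by
  simpa using NonnegAffine.coord_add i le_rfl

lemma NonnegAffine.mul_deg {d : ℕ} {C β : ℝ} (hC : 0 ≤ C) (hβ : 0 ≤ β) :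
    NonnegAffine d (fun n => C * (degIdx d n + β)) :=
  ⟨C * β, fun _ => C, by positivity, fun _ => hC, fun n => by
    simp only [← Finset.mul_sum, degIdx]; push_cast; ring⟩

/-- Every nonnegative affine function is dominated by a multiple of `|𝔫| + β`. -/
lemma NonnegAffine.exists_dominated {d : ℕ} {g : (Fin d → ℕ) → ℝ} (hg : NonnegAffine d g)
    {β : ℝ} (hβ : 0 < β) :
    ∃ C₀ : ℝ, 0 ≤ C₀ ∧ ∀ C, C₀ ≤ C → NonnegAffine d (fun n => C * (degIdx d n + β) - g n) := by
  obtain ⟨a, b, ha, hb, h⟩ := hg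
  have hs : 0 ≤ ∑ i, b i := Finset.sum_nonneg fun i _ => hb i
  refine ⟨a / β + ∑ i, b i, by positivity, fun C hC => ⟨C * β - a, fun i => C - b i, ?_, ?_, ?_⟩⟩
  · have : a / β ≤ C := by linarith
    rw [div_le_iff₀ hβ] at this
    linarith
  · intro i
    have h1 := Finset.single_le_sum (fun i _ => hb i) (Finset.mem_univ i)
    have : 0 ≤ a / β := by positivity
    linarith
  · intro n
    simp only [h, sub_mul, Finset.sum_sub_distrib, ← Finset.mul_sum, degIdx]
    push_cast
    ring

section Quadratic

variable {d : ℕ} {X : Subalgebra ℂ (BdOp d)} {β : ℝ}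

lemma DiagSumSq.nonnegAffine_mul
    (h0 : DiagSumSq X (fun n => 1 / (degIdx d n + β) ^ 2))
    (h1 : ∀ i, DiagSumSq X (fun n => n i / (degIdx d n + β) ^ 2))
    (h2 : ∀ i j, DiagSumSq X (fun n => n i * n j / (degIdx d n + β) ^ 2))
    {g g' : (Fin d → ℕ) → ℝ} (hg : NonnegAffine d g) (hg' : NonnegAffine d g') :
    DiagSumSq X (fun n => g n * g' n / (degIdx d n + β) ^ 2) := by
  obtain ⟨a, b, ha, hb, h⟩ := hg
  obtain ⟨a', b', ha', hb', h'⟩ := hg'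
  have key := ((h0.smul (mul_nonneg ha ha')).add
    (DiagSumSq.sum Finset.univ fun i _ =>
      (h1 i).smul (add_nonneg (mul_nonneg ha (hb' i)) (mul_nonneg ha' (hb i))))).add
    (DiagSumSq.sum Finset.univ fun i _ => DiagSumSq.sum Finset.univ fun j _ =>
      (h2 i j).smul (mul_nonneg (hb i) (hb' j)))
  convert key using 2 with n
  have e : (∑ i, b i * (n i : ℝ)) * ∑ j, b' j * (n j : ℝ) =
      ∑ i, ∑ j, b i * b' j * (n i * n j) := by
    rw [Finset.sum_mul_sum]
    exact Finset.sum_congr rfl fun i _ => Finset.sum_congr rfl fun j _ => by ring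
  simp only [h, h', ← mul_div_assoc, ← Finset.sum_div, ← add_div, add_mul, mul_add, e,
    Finset.sum_add_distrib, mul_assoc, ← Finset.mul_sum]
  ring

lemma DiagSumSq.exists_sub_nonnegAffine_mul (hβ : 0 < β)
    (h0 : DiagSumSq X (fun n => 1 / (degIdx d n + β) ^ 2))
    (h1 : ∀ i, DiagSumSq X (fun n => n i / (degIdx d n + β) ^ 2))
    (h2 : ∀ i j, DiagSumSq X (fun n => n i * n j / (degIdx d n + β) ^ 2))
    {g g' : (Fin d → ℕ) → ℝ} (hg : NonnegAffine d g) (hg' : NonnegAffine d g') :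
    ∃ lam : ℝ, 0 ≤ lam ∧ DiagSumSq X (fun n => lam - g n * g' n / (degIdx d n + β) ^ 2) := by
  obtain ⟨C, hC, hC'⟩ := hg.exists_dominated hβ
  obtain ⟨C', hC'0, hC''⟩ := hg'.exists_dominated hβ
  have hM : 0 ≤ C + C' := by positivity
  refine ⟨(C + C') ^ 2, by positivity, ?_⟩
  convert (DiagSumSq.nonnegAffine_mul h0 h1 h2 (hC' (C + C') (by linarith))
    (NonnegAffine.mul_deg hM hβ.le)).add
    (DiagSumSq.nonnegAffine_mul h0 h1 h2 hg (hC'' (C + C') (by linarith))) using 2 with n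
  have : (degIdx d n : ℝ) + β ≠ 0 := by positivity
  field_simp
  ring

end Quadratic

section Ladder

variable {d : ℕ}

@[simp] lemma aIdx_zero (n : Fin d → ℕ) : aIdx d 0 n = n := by simp [aIdx]

@[simp] lemma aCoef_zero (n : Fin d → ℕ) : aCoef d 0 n = 1 := by simp [aCoef]

lemma aIdx_pos (i : Fin d) (n : Fin d → ℕ) :
    aIdx d ((i : ℤ) + 1) n = Function.update n i (n i - 1) := by
  have h : 0 < (i : ℤ) + 1 ∧ (i : ℤ) + 1 ≤ d := by omega
  simp [aIdx, h]

lemma aCoef_pos (i : Fin d) (n : Fin d → ℕ) : aCoef d ((i : ℤ) + 1) n = √(n i) := by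
  have h : 0 < (i : ℤ) + 1 ∧ (i : ℤ) + 1 ≤ d := by omega
  simp [aCoef, h]

lemma aIdx_neg (i : Fin d) (n : Fin d → ℕ) :
    aIdx d (-((i : ℤ) + 1)) n = Function.update n i (n i + 1) := by
  have h : ¬ (0 < -((i : ℤ) + 1) ∧ -((i : ℤ) + 1) ≤ d) := by omega
  have h' : 0 < - -((i : ℤ) + 1) ∧ - -((i : ℤ) + 1) ≤ d := by omega
  rw [aIdx, dif_neg h, dif_pos h']
  simp

lemma aCoef_neg (i : Fin d) (n : Fin d → ℕ) :
    aCoef d (-((i : ℤ) + 1)) n = √(n i + 1) := by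
  have h : ¬ (0 < -((i : ℤ) + 1) ∧ -((i : ℤ) + 1) ≤ d) := by omega
  have h' : 0 < - -((i : ℤ) + 1) ∧ - -((i : ℤ) + 1) ≤ d := by omega
  rw [aCoef, dif_neg h, dif_pos h']
  simp

lemma ladder_index_cases {k : ℤ} (hk : |k| ≤ d) :
    k = 0 ∨ (∃ i : Fin d, k = (i : ℤ) + 1) ∨ ∃ i : Fin d, k = -((i : ℤ) + 1) := by
  rw [abs_le] at hk
  rcases lt_trichotomy k 0 with h | h | h
  · exact Or.inr (Or.inr ⟨⟨(-k - 1).toNat, by omega⟩, by simp; omega⟩)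
  · exact Or.inl h
  · exact Or.inr (Or.inl ⟨⟨(k - 1).toNat, by omega⟩, by simp; omega⟩)

lemma aIdx_injOn {k : ℤ} (hk : |k| ≤ d) {m n : Fin d → ℕ} (hm : aCoef d k m ≠ 0)
    (hn : aCoef d k n ≠ 0) (h : aIdx d k m = aIdx d k n) : m = n := by
  rcases ladder_index_cases hk with rfl | ⟨i, rfl⟩ | ⟨i, rfl⟩
  · simpa using h
  · rw [aCoef_pos] at hm hn
    rw [aIdx_pos, aIdx_pos] at h
    have hm' : m i ≠ 0 := fun h => hm (by simp [h])
    have hn' : n i ≠ 0 := fun h => hn (by simp [h])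
    ext j
    have := congrFun h j
    by_cases hj : j = i
    · subst hj
      simp at this
      omega
    · simpa [hj] using this
  · rw [aIdx_neg, aIdx_neg] at h
    ext j
    have := congrFun h j
    by_cases hj : j = i
    · subst hj
      simpa using this
    · simpa [hj] using this

lemma xIdx_injOn {k l : ℤ} (hk : |k| ≤ d) (hl : |l| ≤ d) {m n : Fin d → ℕ}
    (hm : aCoef d k (aIdx d l m) * aCoef d l m ≠ 0)
    (hn : aCoef d k (aIdx d l n) * aCoef d l n ≠ 0) (h : xIdx d k l m = xIdx d k l n) : m = n :=
  aIdx_injOn hl (right_ne_zero_of_mul hm) (right_ne_zero_of_mul hn)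
    (aIdx_injOn hk (left_ne_zero_of_mul hm) (left_ne_zero_of_mul hn) h)

lemma degIdx_aIdx_neg (i : Fin d) (n : Fin d → ℕ) :
    degIdx d (aIdx d (-((i : ℤ) + 1)) n) = degIdx d n + 1 := by
  rw [aIdx_neg, degIdx, degIdx, Finset.sum_update_of_mem (Finset.mem_univ i),
    Finset.sdiff_singleton_eq_erase, ← Finset.add_sum_erase _ n (Finset.mem_univ i)]
  ring

/-- The squared matrix coefficients of `a_k a_l` are products of two nonnegative affine functions,
up to subtracting a third one. -/
lemma exists_sq_coef_eq {k l : ℤ} (hk : |k| ≤ d) (hl : |l| ≤ d) :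
    ∃ g g' r : (Fin d → ℕ) → ℝ, NonnegAffine d g ∧ NonnegAffine d g' ∧ NonnegAffine d r ∧
      ∀ n, (aCoef d k (aIdx d l n) * aCoef d l n) ^ 2 = g n * g' n - r n := by
  have h0 : NonnegAffine d (fun _ => 0) := NonnegAffine.const le_rfl
  have h1 : NonnegAffine d (fun _ => 1) := NonnegAffine.const zero_le_one
  have hc := fun i : Fin d => NonnegAffine.coord i
  have hc1 := fun i : Fin d => NonnegAffine.coord_add i zero_le_one
  have hc2 := fun i : Fin d => NonnegAffine.coord_add i zero_le_two
  rcases ladder_index_cases hl with rfl | ⟨j, rfl⟩ | ⟨j, rfl⟩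
  · rcases ladder_index_cases hk with rfl | ⟨i, rfl⟩ | ⟨i, rfl⟩
    · exact ⟨_, _, _, h1, h1, h0, fun n => by simp⟩
    · exact ⟨_, _, _, hc i, h1, h0, fun n => by simp [aCoef_pos]⟩
    · refine ⟨_, _, _, hc1 i, h1, h0, fun n => ?_⟩
      simp only [aCoef_neg, aIdx_zero, aCoef_zero, mul_pow]
      rw [Real.sq_sqrt (by positivity)]
      ring
  · rcases ladder_index_cases hk with rfl | ⟨i, rfl⟩ | ⟨i, rfl⟩
    · exact ⟨_, _, _, hc j, h1, h0, fun n => by simp [aCoef_pos]⟩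
    · by_cases hij : i = j
      · subst hij
        refine ⟨_, _, _, hc i, hc i, hc i, fun n => ?_⟩
        simp only [aCoef_pos, aIdx_pos, mul_pow, Function.update_self]
        rw [Real.sq_sqrt (by positivity), Real.sq_sqrt (by positivity)]
        rcases Nat.eq_zero_or_pos (n i) with h | h
        · simp [h]
        · rw [Nat.cast_sub h]; push_cast; ring
      · refine ⟨_, _, _, hc i, hc j, h0, fun n => ?_⟩
        simp only [aCoef_pos, aIdx_pos, mul_pow, Function.update_of_ne hij]
        rw [Real.sq_sqrt (by positivity), Real.sq_sqrt (by positivity)]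
        ring
    · by_cases hij : i = j
      · subst hij
        refine ⟨_, _, _, hc i, hc i, h0, fun n => ?_⟩
        simp only [aCoef_pos, aCoef_neg, aIdx_pos, mul_pow, Function.update_self]
        rw [Real.sq_sqrt (by positivity), Real.sq_sqrt (by positivity)]
        rcases Nat.eq_zero_or_pos (n i) with h | h
        · simp [h]
        · rw [Nat.cast_sub h]; push_cast; ring
      · refine ⟨_, _, _, hc1 i, hc j, h0, fun n => ?_⟩
        simp only [aCoef_pos, aCoef_neg, aIdx_pos, mul_pow, Function.update_of_ne hij]
        rw [Real.sq_sqrt (by positivity), Real.sq_sqrt (by positivity)]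
        ring
  · rcases ladder_index_cases hk with rfl | ⟨i, rfl⟩ | ⟨i, rfl⟩
    · refine ⟨_, _, _, hc1 j, h1, h0, fun n => ?_⟩
      simp only [aCoef_neg, aCoef_zero, mul_pow]
      rw [Real.sq_sqrt (by positivity)]
      ring
    · by_cases hij : i = j
      · subst hij
        refine ⟨_, _, _, hc1 i, hc1 i, h0, fun n => ?_⟩
        simp only [aCoef_pos, aCoef_neg, aIdx_neg, mul_pow, Function.update_self]
        rw [Real.sq_sqrt (by positivity), Real.sq_sqrt (by positivity)]
        push_cast; ring
      · refine ⟨_, _, _, hc i, hc1 j, h0, fun n => ?_⟩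
        simp only [aCoef_pos, aCoef_neg, aIdx_neg, mul_pow, Function.update_of_ne hij]
        rw [Real.sq_sqrt (by positivity), Real.sq_sqrt (by positivity)]
        ring
    · by_cases hij : i = j
      · subst hij
        refine ⟨_, _, _, hc2 i, hc1 i, h0, fun n => ?_⟩
        simp only [aCoef_neg, aIdx_neg, mul_pow, Function.update_self]
        rw [Real.sq_sqrt (by positivity), Real.sq_sqrt (by positivity)]
        push_cast; ring
      · refine ⟨_, _, _, hc1 i, hc1 j, h0, fun n => ?_⟩
        simp only [aCoef_neg, aIdx_neg, mul_pow, Function.update_of_ne hij]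
        rw [Real.sq_sqrt (by positivity), Real.sq_sqrt (by positivity)]
        ring

end Ladder

section Generators

variable {d : ℕ} {α : ℝ} {xop : ℤ → ℤ → BdOp d} {yop : ℤ → BdOp d}

lemma xop_mem_Xalg {k l : ℤ} (hk : |k| ≤ d) (hl : |l| ≤ d) : xop k l ∈ Xalg d xop yop :=
  Algebra.subset_adjoin (Or.inl ⟨k, l, hk, hl, rfl⟩)

lemma yop_mem_Xalg (m : ℕ) : yop m ∈ Xalg d xop yop :=
  Algebra.subset_adjoin (Or.inr ⟨m, rfl⟩)

/-- `X` contains the weighted shifts `a_k a_l (N + α + m)⁻¹` for `k, l ≥ 0`, so their squared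
weights are diagonals of sums of squares. -/
lemma DiagSumSq.sq_coef_div (hα : 0 < α) (hxy : IsXYSystem d α xop yop) (m : ℕ) {k l : ℤ}
    (hk : |k| ≤ d) (hl : |l| ≤ d) (hk0 : 0 ≤ k) :
    DiagSumSq (Xalg d xop yop)
      (fun n => (aCoef d k (aIdx d l n) * aCoef d l n / (degIdx d n + (α + m))) ^ 2) := by
  refine DiagSumSq.of_shift (T := xop k l * (1 - (m : ℂ) • yop m)) (f := xIdx d k l) ?_ ?_ ?_
  · refine Subalgebra.mul_mem _ (xop_mem_Xalg hk hl)
      (Subalgebra.sub_mem _ (Subalgebra.one_mem _) (Subalgebra.smul_mem _ (yop_mem_Xalg m) _))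
  · intro n
    have hy : ((1 : BdOp d) - (m : ℂ) • yop m) (e2 d n) =
        (((degIdx d n + α) / (degIdx d n + (α + m)) : ℝ) : ℂ) • e2 d n := by
      rw [sub_apply, smul_apply,
        one_apply_eq_self, hxy.2, smul_smul]
      nth_rewrite 1 [← one_smul ℂ (e2 d n)]
      rw [← sub_smul]
      congr 1
      rw [← Complex.ofReal_natCast, ← Complex.ofReal_mul, ← Complex.ofReal_one,
        ← Complex.ofReal_sub, yCoef]
      congr 1
      have : (degIdx d n : ℝ) + (α + m) ≠ 0 := by positivity
      have h' : (degIdx d n : ℝ) + α + m ≠ 0 := by positivity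
      push_cast
      field_simp
      ring
    rw [mul_apply_eq_comp, hy, map_smul, hxy.1 k l hk hl, smul_smul,
      ← Complex.ofReal_mul, xCoef, if_pos (Or.inl hk0)]
    congr 2
    have : (degIdx d n : ℝ) + α ≠ 0 := by positivity
    field_simp
  · intro n n' hn hn' h
    exact xIdx_injOn hk hl (div_ne_zero_iff.1 hn).1 (div_ne_zero_iff.1 hn').1 h

lemma DiagSumSq.exists_sub_sq_coef_div (hα : 0 < α) (hxy : IsXYSystem d α xop yop) (m : ℕ)
    {k l : ℤ} (hk : |k| ≤ d) (hl : |l| ≤ d) :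
    ∃ lam : ℝ, 0 ≤ lam ∧ DiagSumSq (Xalg d xop yop) (fun n => lam -
      (aCoef d k (aIdx d l n) * aCoef d l n / (degIdx d n + (α + m))) ^ 2) := by
  have hβ : 0 < α + m := by positivity
  have hz : |(0 : ℤ)| ≤ d := by simp
  have hi : ∀ i : Fin d, |(i : ℤ) + 1| ≤ d := fun i => by rw [abs_le]; omega
  have h0 : DiagSumSq (Xalg d xop yop) (fun n => 1 / ((degIdx d n : ℝ) + (α + m)) ^ 2) := by
    convert DiagSumSq.sq_coef_div hα hxy m hz hz le_rfl using 2 with n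
    simp
  have h1 : ∀ i, DiagSumSq (Xalg d xop yop)
      (fun n => n i / ((degIdx d n : ℝ) + (α + m)) ^ 2) := fun i => by
    convert DiagSumSq.sq_coef_div hα hxy m hz (hi i) le_rfl using 2 with n
    rw [div_pow]
    simp [aCoef_pos]
  have h2 : ∀ i j, DiagSumSq (Xalg d xop yop)
      (fun n => n i * n j / ((degIdx d n : ℝ) + (α + m)) ^ 2) := fun i j => by
    have key := DiagSumSq.sq_coef_div hα hxy m (hi i) (hi j) (by positivity)
    by_cases hij : i = j
    · subst hij
      convert key.add (h1 i) using 2 with n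
      simp only [aCoef_pos, aIdx_pos, Function.update_self]
      rw [div_pow, mul_pow, Real.sq_sqrt (by positivity), Real.sq_sqrt (by positivity),
        ← add_div]
      congr 1
      rcases Nat.eq_zero_or_pos (n i) with h | h
      · simp [h]
      · rw [Nat.cast_sub h]; push_cast; ring
    · convert key using 2 with n
      simp only [aCoef_pos, aIdx_pos, Function.update_of_ne hij]
      rw [div_pow, mul_pow, Real.sq_sqrt (by positivity), Real.sq_sqrt (by positivity)]
  obtain ⟨g, g', r, hg, hg', hr, h⟩ := exists_sq_coef_eq hk hl
  obtain ⟨lam, hlam, hl⟩ := DiagSumSq.exists_sub_nonnegAffine_mul hβ h0 h1 h2 hg hg'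
  refine ⟨lam, hlam, ?_⟩
  convert hl.add (DiagSumSq.nonnegAffine_mul h0 h1 h2 hr (NonnegAffine.const zero_le_one))
    using 2 with n
  rw [div_pow, h]
  ring

lemma sqBounded_xop (hα : 0 < α) (hxy : IsXYSystem d α xop yop) {k l : ℤ}
    (hk : |k| ≤ d) (hl : |l| ≤ d) : SqBounded (Xalg d xop yop) (xop k l) := by
  refine SqBounded.of_diagSumSq (hxy.1 k l hk hl) (fun n n' hn hn' h => ?_) ?_
  · unfold xCoef at hn hn'
    split_ifs at hn hn' <;>
      exact xIdx_injOn hk hl (div_ne_zero_iff.1 hn).1 (div_ne_zero_iff.1 hn').1 h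
  · by_cases h : 0 ≤ k ∨ 0 ≤ l
    · simpa [xCoef, h] using DiagSumSq.exists_sub_sq_coef_div hα hxy 0 hk hl
    · convert DiagSumSq.exists_sub_sq_coef_div hα hxy 2 hk hl using 5 with lam n
      rw [xCoef, if_neg h]
      push Not at h
      obtain ⟨i, rfl⟩ : ∃ i : Fin d, k = -((i : ℤ) + 1) := by
        rcases ladder_index_cases hk with rfl | ⟨i, rfl⟩ | hi
        · omega
        · omega
        · exact hi
      obtain ⟨j, rfl⟩ : ∃ j : Fin d, l = -((j : ℤ) + 1) := by
        rcases ladder_index_cases hl with rfl | ⟨i, rfl⟩ | hi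
        · omega
        · omega
        · exact hi
      rw [xIdx, degIdx_aIdx_neg, degIdx_aIdx_neg]
      push_cast
      congr 1
      ring

lemma sqBounded_yop (hα : 0 < α) (hxy : IsXYSystem d α xop yop) (m : ℕ) :
    SqBounded (Xalg d xop yop) (yop m) := by
  refine SqBounded.of_diagSumSq (f := id) (hxy.2 m) (fun _ _ _ _ h => h) ?_
  have hz : |(0 : ℤ)| ≤ d := by simp
  convert DiagSumSq.exists_sub_sq_coef_div hα hxy m hz hz using 5 with lam n
  simp [yCoef, add_assoc]

lemma sqBounded_of_mem (hα : 0 < α) (hxy : IsXYSystem d α xop yop) {T : BdOp d}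
    (hT : T ∈ Xalg d xop yop) : SqBounded (Xalg d xop yop) T := by
  refine Algebra.adjoin_induction (p := fun T _ => SqBounded (Xalg d xop yop) T)
    ?_ ?_ ?_ ?_ hT
  · rintro T (⟨k, l, hk, hl, rfl⟩ | ⟨m, rfl⟩)
    · exact sqBounded_xop hα hxy hk hl
    · exact sqBounded_yop hα hxy m
  · exact SqBounded.algebraMap
  · exact fun a b ha hb => SqBounded.add ha hb
  · exact fun a b _ hb => SqBounded.mul hb

end Generators

/-- Lemma 3.1: the auxiliary ∗-algebra `X` is algebraically bounded. -/
theorem stmt9 (d : ℕ) (hd : 1 ≤ d) (α : ℝ) (hα : 0 < α)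
    (hαint : ∀ z : ℤ, α ≠ (z : ℝ))
    (xop : ℤ → ℤ → BdOp d) (yop : ℤ → BdOp d)
    (hxy : IsXYSystem d α xop yop)
    (T : BdOp d) (hT : T ∈ Xalg d xop yop) :
    ∃ lam : ℝ, 0 < lam ∧
      (lam : ℂ) • (1 : BdOp d) + (2 : ℂ)⁻¹ • (T + star T) ∈ XSumSq d (Xalg d xop yop) ∧
      (lam : ℂ) • (1 : BdOp d) - (2 : ℂ)⁻¹ • (T + star T) ∈ XSumSq d (Xalg d xop yop) ∧
      (lam : ℂ) • (1 : BdOp d) + (Complex.I * 2⁻¹) • (star T - T) ∈ XSumSq d (Xalg d xop yop) ∧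
      (lam : ℂ) • (1 : BdOp d) - (Complex.I * 2⁻¹) • (star T - T) ∈ XSumSq d (Xalg d xop yop) := by
  obtain ⟨r, hr, h⟩ := sqBounded_of_mem hα hxy hT
  refine ⟨(r + 1) / 2, by positivity, ?_, ?_, ?_, ?_⟩
  · simpa using SqBounded.add_re hT h (c := 1) (by simp)
  · convert SqBounded.add_re hT h (c := -1) (by simp) using 1
    simp only [star_neg, star_one, neg_smul, one_smul, ← neg_add, smul_neg, sub_eq_add_neg]
  · convert SqBounded.add_re hT h (c := -Complex.I) (by simp) using 2
    rw [mul_comm, mul_smul]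
    congr 1
    simp only [star_neg, Complex.star_def, Complex.conj_I, neg_neg, neg_smul, smul_sub]
    abel
  · convert SqBounded.add_re hT h (c := Complex.I) (by simp) using 1
    rw [mul_comm, mul_smul, sub_eq_add_neg, ← smul_neg]
    congr 2
    simp only [Complex.star_def, Complex.conj_I, neg_smul, smul_sub]
    abel
end
end
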